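/- If G has finite exponent n and the derived subgroup G' has finite exponent m, then the subgroup R = ⁅⁅G₁,L⁆,G₂⁆ of the weak commutativity group χ(G) has finite exponent dividing n·m. -/

import Mathlib

open Subgroup

/-- The weak commutativity relations inside the free product `G ∗ G`. -/
def chiRel (G : Type*) [Group G] : Subgroup (Monoid.Coprod G G) :=
  Subgroup.normalClosure
    {x | ∃ g : G, x = Monoid.Coprod.inl g * Monoid.Coprod.inr g *
      (Monoid.Coprod.inl g)⁻¹ * (Monoid.Coprod.inr g)⁻¹}

instance chiRel_normal (G : Type*) [Group G] : (chiRel G).Normal :=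
  Subgroup.normalClosure_normal

/-- The weak commutativity group `χ(G)`. -/
def Chi (G : Type*) [Group G] : Type _ := Monoid.Coprod G G ⧸ chiRel G

instance (G : Type*) [Group G] : Group (Chi G) :=
  inferInstanceAs (Group (Monoid.Coprod G G ⧸ chiRel G))

/-- The canonical map `G → χ(G)`, `g ↦ g`. -/
def chiIota1 (G : Type*) [Group G] : G →* Chi G :=
  (QuotientGroup.mk' (chiRel G)).comp Monoid.Coprod.inl

/-- The canonical map `G → χ(G)`, `g ↦ g^φ`. -/
def chiIota2 (G : Type*) [Group G] : G →* Chi G :=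
  (QuotientGroup.mk' (chiRel G)).comp Monoid.Coprod.inr

/-- `G₁ ≤ χ(G)`. -/
def chiG1 (G : Type*) [Group G] : Subgroup (Chi G) := (chiIota1 G).range

/-- `G₂ = G^φ ≤ χ(G)`. -/
def chiG2 (G : Type*) [Group G] : Subgroup (Chi G) := (chiIota2 G).range

/-- `L = ⟨g⁻¹ g^φ : g ∈ G⟩`. -/
def chiL (G : Type*) [Group G] : Subgroup (Chi G) :=
  Subgroup.closure {x | ∃ g : G, x = (chiIota1 G g)⁻¹ * chiIota2 G g}

/-- `D = ⁅G₁, G₂⁆`. -/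
def chiD (G : Type*) [Group G] : Subgroup (Chi G) := ⁅chiG1 G, chiG2 G⁆

/-- `L₁ = ⁅L, G₁⁆`. -/
def chiL1 (G : Type*) [Group G] : Subgroup (Chi G) := ⁅chiL G, chiG1 G⁆

/-- `L₂ = ⁅L, G₂⁆`. -/
def chiL2 (G : Type*) [Group G] : Subgroup (Chi G) := ⁅chiL G, chiG2 G⁆

/-- `R = ⁅⁅G₁, L⁆, G₂⁆`. -/
def chiR (G : Type*) [Group G] : Subgroup (Chi G) := ⁅⁅chiG1 G, chiL G⁆, chiG2 G⁆

/-- `L₁₂ = ⁅L₁, L₂⁆`. -/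
def chiL12 (G : Type*) [Group G] : Subgroup (Chi G) := ⁅chiL1 G, chiL2 G⁆

section ChiAux

open scoped commutatorElement

variable {G : Type*} [Group G]

theorem chi_comm (g : G) : chiIota1 G g * chiIota2 G g = chiIota2 G g * chiIota1 G g := by
  have h : (QuotientGroup.mk' (chiRel G)) (Monoid.Coprod.inl g * Monoid.Coprod.inr g *
      (Monoid.Coprod.inl g)⁻¹ * (Monoid.Coprod.inr g)⁻¹) = 1 := by
    rw [← MonoidHom.mem_ker, QuotientGroup.ker_mk']
    exact Subgroup.subset_normalClosure ⟨g, rfl⟩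
  simp only [map_mul, map_inv] at h
  have h2 : chiIota1 G g * chiIota2 G g * (chiIota1 G g)⁻¹ * (chiIota2 G g)⁻¹ = 1 := h
  rw [mul_inv_eq_one, mul_inv_eq_iff_eq_mul] at h2
  exact h2

theorem chi_ind {p : Chi G → Prop} (h1 : ∀ g, p (chiIota1 G g)) (h2 : ∀ g, p (chiIota2 G g))
    (hm : ∀ x y, p x → p y → p (x * y)) (x : Chi G) : p x := by
  obtain ⟨y, rfl⟩ : ∃ y, QuotientGroup.mk' (chiRel G) y = x :=
    QuotientGroup.mk'_surjective (chiRel G) x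
  induction y using Monoid.Coprod.induction_on with
  | inl g => exact h1 g
  | inr g => exact h2 g
  | mul a b ha hb =>
    rw [map_mul]
    exact hm _ _ ha hb

/-- `⁅g, h^φ⁆ = ⁅g^φ, h⁆`. -/
theorem chi_swap (g h : G) :
    ⁅chiIota1 G g, chiIota2 G h⁆ = ⁅chiIota2 G g, chiIota1 G h⁆ := by
  have hg := chi_comm g
  have hh := chi_comm h
  have hgh := chi_comm (g⁻¹ * h)
  simp only [map_mul, map_inv] at hgh
  generalize chiIota1 G g = a at *
  generalize chiIota2 G g = b at *
  generalize chiIota1 G h = c at *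
  generalize chiIota2 G h = d at *
  -- a⁻¹ c b⁻¹ d = b⁻¹ d a⁻¹ c
  rw [commutatorElement_def, commutatorElement_def]
  have hg' : a * b⁻¹ = b⁻¹ * a := by
    rw [mul_inv_eq_iff_eq_mul, mul_assoc, hg, inv_mul_cancel_left]
  have hh' : d * c⁻¹ = c⁻¹ * d := by
    rw [mul_inv_eq_iff_eq_mul, mul_assoc, ← hh, inv_mul_cancel_left]
  have e1 : c * b⁻¹ * d = a * b⁻¹ * d * a⁻¹ * c := by
    calc c * b⁻¹ * d = a * (a⁻¹ * c * (b⁻¹ * d)) := by group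
      _ = a * (b⁻¹ * d * (a⁻¹ * c)) := by rw [hgh]
      _ = _ := by group
  have e2 : c * b⁻¹ * d * c⁻¹ = a * b⁻¹ * d * a⁻¹ := by rw [e1]; group
  have e3 : b * (c * b⁻¹ * (c⁻¹ * d)) = b * (b⁻¹ * a * d * a⁻¹) := by
    rw [← hh', ← hg', ← e2]; group
  have e4 : a * d * a⁻¹ = b * c * b⁻¹ * c⁻¹ * d := by
    calc a * d * a⁻¹ = b * (b⁻¹ * a * d * a⁻¹) := by group
      _ = _ := by rw [← e3]; group
  rw [e4]; group

theorem chi_conj (g h k : G) :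
    chiIota1 G k * ⁅chiIota1 G g, chiIota2 G h⁆ * (chiIota1 G k)⁻¹ =
    chiIota2 G k * ⁅chiIota1 G g, chiIota2 G h⁆ * (chiIota2 G k)⁻¹ := by
  have h1 := chi_swap (k * g) h
  have h2 := chi_swap g h
  have h3 := chi_swap k h
  simp only [map_mul] at h1
  have key : ∀ x y z : Chi G, ⁅x * y, z⁆ = x * ⁅y, z⁆ * x⁻¹ * ⁅x, z⁆ := by
    intro x y z; simp only [commutatorElement_def]; group
  rw [key, key, h3, ← h2] at h1
  exact mul_right_cancel h1

theorem chi_L_mem (g : G) : (chiIota1 G g)⁻¹ * chiIota2 G g ∈ chiL G :=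
  Subgroup.subset_closure ⟨g, rfl⟩

theorem chi_DL {d l : Chi G} (hd : d ∈ chiD G) (hl : l ∈ chiL G) : l * d = d * l := by
  have : chiD G ≤ Subgroup.centralizer (chiL G : Set (Chi G)) := by
    rw [chiD, Subgroup.commutator_le]
    rintro _ ⟨g, rfl⟩ _ ⟨h, rfl⟩
    rw [chiL, Subgroup.centralizer_closure, Subgroup.mem_centralizer_iff]
    rintro _ ⟨k, rfl⟩
    have := chi_conj g h k
    generalize ⁅chiIota1 G g, chiIota2 G h⁆ = w at *
    rw [eq_comm, mul_inv_eq_iff_eq_mul] at this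
    rw [mul_assoc, this]; group
  exact (Subgroup.mem_centralizer_iff.1 (this hd)) l hl

theorem chi_L_conj (x : Chi G) : ∀ l ∈ chiL G, x * l * x⁻¹ ∈ chiL G := by
  have i1 : ∀ h : G, ∀ l ∈ chiL G, chiIota1 G h * l * (chiIota1 G h)⁻¹ ∈ chiL G := by
    intro h l hl
    induction hl using Subgroup.closure_induction with
    | mem y hy =>
      obtain ⟨k, rfl⟩ := hy
      have := (chiL G).mul_mem (chi_L_mem (k * h⁻¹)) ((chiL G).inv_mem (chi_L_mem h⁻¹))
      convert this using 1
      simp only [map_mul, map_inv]; group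
    | one => simp [(chiL G).one_mem]
    | mul a b _ _ ha hb =>
      convert (chiL G).mul_mem ha hb using 1
      group
    | inv a _ ha =>
      convert (chiL G).inv_mem ha using 1
      group
  induction x using chi_ind with
  | h1 g => exact i1 g
  | h2 g =>
    intro l hl
    have hm := chi_L_mem g
    have := i1 g _ ((chiL G).mul_mem ((chiL G).mul_mem hm hl) ((chiL G).inv_mem hm))
    convert this using 1
    group
  | hm x y hx hy =>
    intro l hl
    convert hx _ (hy l hl) using 1
    group

instance chiL_normal' : (chiL G).Normal := ⟨fun l hl x => chi_L_conj x l hl⟩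

theorem chi_closure_top : chiG1 G ⊔ chiG2 G = ⊤ := by
  rw [eq_top_iff]
  intro x _
  induction x using chi_ind with
  | h1 g => exact Subgroup.mem_sup_left ⟨g, rfl⟩
  | h2 g => exact Subgroup.mem_sup_right ⟨g, rfl⟩
  | hm x y hx hy => exact Subgroup.mul_mem _ (hx trivial) (hy trivial)

theorem chi_D_conj (x : Chi G) : ∀ d ∈ chiD G, x * d * x⁻¹ ∈ chiD G := by
  have key : ∀ x y z : Chi G, x * ⁅y, z⁆ * x⁻¹ = ⁅x * y, z⁆ * ⁅x, z⁆⁻¹ := by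
    intro x y z; simp only [commutatorElement_def]; group
  have i1 : ∀ k : G, ∀ d ∈ chiD G, chiIota1 G k * d * (chiIota1 G k)⁻¹ ∈ chiD G := by
    intro k d hd
    rw [chiD, Subgroup.commutator_def] at hd
    induction hd using Subgroup.closure_induction with
    | mem y hy =>
      obtain ⟨_, ⟨g, rfl⟩, _, ⟨h, rfl⟩, rfl⟩ := hy
      rw [key, ← map_mul]
      exact (chiD G).mul_mem (Subgroup.commutator_mem_commutator ⟨_, rfl⟩ ⟨_, rfl⟩)
        ((chiD G).inv_mem (Subgroup.commutator_mem_commutator ⟨_, rfl⟩ ⟨_, rfl⟩))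
    | one => simp [(chiD G).one_mem]
    | mul a b _ _ ha hb =>
      convert (chiD G).mul_mem ha hb using 1
      group
    | inv a _ ha =>
      convert (chiD G).inv_mem ha using 1
      group
  induction x using chi_ind with
  | h1 g => exact i1 g
  | h2 g =>
    intro d hd
    have e : chiIota2 G g * d * (chiIota2 G g)⁻¹ = chiIota1 G g * d * (chiIota1 G g)⁻¹ := by
      have := chi_DL hd (chi_L_mem g)
      calc chiIota2 G g * d * (chiIota2 G g)⁻¹
          = chiIota1 G g * ((chiIota1 G g)⁻¹ * chiIota2 G g * d) * (chiIota2 G g)⁻¹ := by group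
        _ = _ := by rw [this]; group
    rw [e]; exact i1 g d hd
  | hm x y hx hy =>
    intro l hl
    convert hx _ (hy l hl) using 1
    group

instance chiD_normal' : (chiD G).Normal := ⟨fun l hl x => chi_D_conj x l hl⟩

/-- The projection `χ(G) → χ(G)/D`. -/
def chiQ (G : Type*) [Group G] : Chi G →* Chi G ⧸ chiD G := QuotientGroup.mk' (chiD G)

theorem chiQ_eq_one {x : Chi G} : chiQ G x = 1 ↔ x ∈ chiD G := by
  rw [chiQ, ← MonoidHom.mem_ker, QuotientGroup.ker_mk']

theorem chiQ_comm (g h : G) : chiQ G (chiIota1 G g) * chiQ G (chiIota2 G h) =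
    chiQ G (chiIota2 G h) * chiQ G (chiIota1 G g) := by
  rw [← commutatorElement_eq_one_iff_mul_comm, ← map_commutatorElement, chiQ_eq_one]
  exact Subgroup.commutator_mem_commutator ⟨_, rfl⟩ ⟨_, rfl⟩

theorem chiQ_form (x : Chi G) :
    ∃ a b : G, chiQ G x = chiQ G (chiIota1 G a) * chiQ G (chiIota2 G b) := by
  induction x using chi_ind with
  | h1 g => exact ⟨g, 1, by simp⟩
  | h2 g => exact ⟨1, g, by simp⟩
  | hm x y hx hy =>
    obtain ⟨a, b, h⟩ := hx
    obtain ⟨c, d, h'⟩ := hy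
    refine ⟨a * c, b * d, ?_⟩
    simp only [map_mul, h, h']
    have := chiQ_comm c b
    simp only [mul_assoc]
    rw [← mul_assoc _ (chiQ G (chiIota1 G c)), ← this]
    simp only [mul_assoc]

theorem chiQ_L1 {x : Chi G} (hx : x ∈ ⁅chiG1 G, chiL G⁆) :
    ∃ c ∈ commutator G, chiQ G x = chiQ G (chiIota1 G c) := by
  rw [Subgroup.commutator_def] at hx
  induction hx using Subgroup.closure_induction with
  | mem y hy =>
    obtain ⟨_, ⟨g, rfl⟩, l, hl, rfl⟩ := hy
    obtain ⟨a, b, h⟩ := chiQ_form l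
    refine ⟨⁅g, a⁆, Subgroup.commutator_mem_commutator trivial trivial, ?_⟩
    have := chiQ_comm g b
    simp only [map_commutatorElement, h]
    simp only [commutatorElement_def]
    generalize chiQ G (chiIota1 G g) = p at *
    generalize chiQ G (chiIota1 G a) = q at *
    generalize chiQ G (chiIota2 G b) = r at *
    calc p * (q * r) * p⁻¹ * (q * r)⁻¹ = p * q * p⁻¹ * (p * r) * p⁻¹ * r⁻¹ * q⁻¹ := by group
      _ = _ := by rw [this]; group
  | one => exact ⟨1, Subgroup.one_mem _, by simp⟩
  | mul a b _ _ ha hb =>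
    obtain ⟨c, hc, h⟩ := ha
    obtain ⟨d, hd, h'⟩ := hb
    exact ⟨c * d, Subgroup.mul_mem _ hc hd, by simp [h, h']⟩
  | inv a _ ha =>
    obtain ⟨c, hc, h⟩ := ha
    exact ⟨c⁻¹, Subgroup.inv_mem _ hc, by simp [h]⟩

theorem L1_le_L : ⁅chiG1 G, chiL G⁆ ≤ chiL G := Subgroup.commutator_le_right _ _

/-- `W = D ∩ L` elements killed by `N`. -/
def chiT (G : Type*) [Group G] (N : ℕ) : Subgroup (Chi G) where
  carrier := {w | w ∈ chiD G ∧ w ∈ chiL G ∧ w ^ N = 1}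
  one_mem' := ⟨Subgroup.one_mem _, Subgroup.one_mem _, one_pow _⟩
  mul_mem' := by
    rintro a b ⟨h1, h2, h3⟩ ⟨k1, k2, k3⟩
    refine ⟨Subgroup.mul_mem _ h1 k1, Subgroup.mul_mem _ h2 k2, ?_⟩
    have : Commute a b := chi_DL k1 h2
    rw [this.mul_pow, h3, k3, one_mul]
  inv_mem' := by
    rintro a ⟨h1, h2, h3⟩
    exact ⟨Subgroup.inv_mem _ h1, Subgroup.inv_mem _ h2, by rw [inv_pow, h3, inv_one]⟩

theorem chi_E_mem {x : Chi G} (hx : x ∈ ⁅chiG1 G, chiL G⁆) (h : G) :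
    ⁅x, chiIota2 G h⁆ ∈ chiD G ∧ ⁅x, chiIota2 G h⁆ ∈ chiL G := by
  constructor
  · obtain ⟨c, -, hc⟩ := chiQ_L1 hx
    rw [← chiQ_eq_one, map_commutatorElement, hc, commutatorElement_eq_one_iff_mul_comm]
    exact chiQ_comm c h
  · rw [commutatorElement_def, mul_assoc, mul_assoc]
    refine Subgroup.mul_mem _ (L1_le_L hx) ?_
    rw [← mul_assoc]
    exact chi_L_conj _ _ (Subgroup.inv_mem _ (L1_le_L hx))

/-- If `⁅x,u⁆` lies in `D` and `x, y ∈ L`, then the commutator is multiplicative. -/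
theorem chi_E_mul {x y u : Chi G} (hx : x ∈ chiL G) (hy : ⁅y, u⁆ ∈ chiD G) :
    ⁅x * y, u⁆ = ⁅y, u⁆ * ⁅x, u⁆ := by
  have h := chi_DL hy hx
  have key : ⁅x * y, u⁆ = x * ⁅y, u⁆ * x⁻¹ * ⁅x, u⁆ := by
    simp only [commutatorElement_def]; group
  rw [key, h, mul_inv_cancel_right]

theorem chi_E_pow {x u : Chi G} (hx : x ∈ chiL G) (hy : ⁅x, u⁆ ∈ chiD G) (N : ℕ) :
    ⁅x ^ N, u⁆ = ⁅x, u⁆ ^ N := by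
  induction N with
  | zero => simp
  | succ k ih =>
    rw [pow_succ, chi_E_mul (Subgroup.pow_mem _ hx k) hy, ih, pow_succ']

/-- Conjugates of `L₁₂`-type commutators are killed by the exponent of `G'`. -/
theorem chi_L12_T {m : ℕ} (hm : ∀ c ∈ commutator G, c ^ m = 1) {y l : Chi G}
    (hy : y ∈ ⁅chiG1 G, chiL G⁆) (hl : l ∈ chiL G) (h : G) (v : Chi G) :
    v * ⁅y, ⁅(chiIota2 G h)⁻¹, l⁻¹⁆⁆ * v⁻¹ ∈ chiT G m := by
  have hyL := L1_le_L hy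
  have huL : ⁅(chiIota2 G h)⁻¹, l⁻¹⁆ ∈ chiL G := by
    rw [commutatorElement_def, inv_inv]
    exact Subgroup.mul_mem _ (by
      have := chi_L_conj (chiIota2 G h)⁻¹ _ (Subgroup.inv_mem _ hl)
      simpa using this) (Subgroup.inv_mem _ (Subgroup.inv_mem _ hl))
  obtain ⟨c, hcm, hc⟩ := chiQ_L1 hy
  have hcD : ⁅y, ⁅(chiIota2 G h)⁻¹, l⁻¹⁆⁆ ∈ chiD G := by
    obtain ⟨a, b, hab⟩ := chiQ_form l
    rw [← chiQ_eq_one, map_commutatorElement, hc, commutatorElement_eq_one_iff_mul_comm]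
    have e : chiQ G ⁅(chiIota2 G h)⁻¹, l⁻¹⁆ = chiQ G (chiIota2 G ⁅h⁻¹, b⁻¹⁆) := by
      have := chiQ_comm a h
      have := chiQ_comm a b
      have e : chiQ G (chiIota1 G a) * chiQ G (chiIota2 G (b⁻¹ * h * b)) =
        chiQ G (chiIota2 G (b⁻¹ * h * b)) * chiQ G (chiIota1 G a) := chiQ_comm _ _
      have e' := chiQ_comm a h
      simp only [map_commutatorElement, map_inv, hab, commutatorElement_def, map_mul] at *
      generalize chiQ G (chiIota1 G a) = p at *
      generalize chiQ G (chiIota2 G b) = r at *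
      generalize chiQ G (chiIota2 G h) = s at *
      have e2 : p⁻¹ * s * p = s := by rw [mul_assoc, ← e', inv_mul_cancel_left]
      calc s⁻¹ * (p * r)⁻¹ * s⁻¹⁻¹ * (p * r)⁻¹⁻¹ = s⁻¹ * r⁻¹ * (p⁻¹ * s * p) * r := by group
        _ = _ := by rw [e2]; group
    rw [e]
    exact chiQ_comm _ _
  refine ⟨chi_D_conj v _ hcD, chi_L_conj v _ ?_, ?_⟩
  · rw [commutatorElement_def]
    exact Subgroup.mul_mem _ (Subgroup.mul_mem _ (Subgroup.mul_mem _ hyL huL)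
      (Subgroup.inv_mem _ hyL)) (Subgroup.inv_mem _ huL)
  · have hyD : y ^ m ∈ chiD G := by
      rw [← chiQ_eq_one, map_pow, hc, ← map_pow, ← map_pow, hm c hcm, map_one, map_one]
    rw [conj_pow, ← chi_E_pow hyL hcD, commutatorElement_eq_one_iff_mul_comm.2, mul_one,
      mul_inv_cancel]
    exact (chi_DL hyD huL).symm

theorem chi_F_mul {m : ℕ} (hm : ∀ c ∈ commutator G, c ^ m = 1) (g h : G) {l l' : Chi G}
    (hl : l ∈ chiL G) (hl' : l' ∈ chiL G) :
    ∃ t ∈ chiT G m, ⁅⁅chiIota1 G g, l * l'⁆, chiIota2 G h⁆ =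
      ⁅⁅chiIota1 G g, l⁆, chiIota2 G h⁆ * ⁅⁅chiIota1 G g, l'⁆, chiIota2 G h⁆ * t := by
  have hx : ⁅chiIota1 G g, l⁆ ∈ ⁅chiG1 G, chiL G⁆ :=
    Subgroup.commutator_mem_commutator ⟨_, rfl⟩ hl
  have hy : ⁅chiIota1 G g, l'⁆ ∈ ⁅chiG1 G, chiL G⁆ :=
    Subgroup.commutator_mem_commutator ⟨_, rfl⟩ hl'
  have e1 : ⁅chiIota1 G g, l * l'⁆ = ⁅chiIota1 G g, l⁆ * (l * ⁅chiIota1 G g, l'⁆ * l⁻¹) := by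
    simp only [commutatorElement_def]; group
  rw [e1]
  generalize ⁅chiIota1 G g, l⁆ = x at *
  generalize ⁅chiIota1 G g, l'⁆ = y at *
  set t := chiIota2 G h * ⁅y, ⁅(chiIota2 G h)⁻¹, l⁻¹⁆⁆ * (chiIota2 G h)⁻¹ with ht
  have htT : t ∈ chiT G m := chi_L12_T hm hy hl h _
  have hyE := chi_E_mem hy h
  have hxE := chi_E_mem hx h
  have e2 : ⁅l * y * l⁻¹, chiIota2 G h⁆ = ⁅y, chiIota2 G h⁆ * t := by
    have : ⁅l * y * l⁻¹, chiIota2 G h⁆ = l * (⁅y, chiIota2 G h⁆ * t) * l⁻¹ := by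
      rw [ht]; simp only [commutatorElement_def]; group
    rw [this, chi_DL (Subgroup.mul_mem _ hyE.1 htT.1) hl, mul_inv_cancel_right]
  refine ⟨t, htT, ?_⟩
  rw [chi_E_mul (L1_le_L hx), e2, mul_assoc ⁅x, _⁆]
  · exact (chi_DL (Subgroup.mul_mem _ hyE.1 htT.1) hxE.2).symm
  · rw [e2]; exact Subgroup.mul_mem _ hyE.1 htT.1

theorem chi_F_pow {m : ℕ} (hm : ∀ c ∈ commutator G, c ^ m = 1) (g h : G) {l : Chi G}
    (hl : l ∈ chiL G) (N : ℕ) :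
    ∃ t ∈ chiT G m, ⁅⁅chiIota1 G g, l ^ N⁆, chiIota2 G h⁆ =
      ⁅⁅chiIota1 G g, l⁆, chiIota2 G h⁆ ^ N * t := by
  induction N with
  | zero => exact ⟨1, Subgroup.one_mem _, by simp⟩
  | succ k ih =>
    obtain ⟨t, ht, e⟩ := ih
    obtain ⟨s, hs, e'⟩ := chi_F_mul hm g h hl (Subgroup.pow_mem _ hl k)
    refine ⟨t * s, Subgroup.mul_mem _ ht hs, ?_⟩
    rw [pow_succ', e', e, pow_succ']
    group

theorem chi_F_T {n m : ℕ} (hn : ∀ g : G, g ^ n = 1) (hm : ∀ c ∈ commutator G, c ^ m = 1)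
    (g h : G) {l : Chi G} (hl : l ∈ chiL G) :
    ⁅⁅chiIota1 G g, l⁆, chiIota2 G h⁆ ∈ chiT G (n * m) := by
  have hT : chiT G m ≤ chiT G (n * m) := by
    rintro w ⟨h1, h2, h3⟩
    exact ⟨h1, h2, by rw [mul_comm, pow_mul, h3, one_pow]⟩
  rw [chiL] at hl
  induction hl using Subgroup.closure_induction with
  | mem y hy =>
    obtain ⟨k, rfl⟩ := hy
    have hk := chi_L_mem k
    have hE := chi_E_mem (Subgroup.commutator_mem_commutator
      (show chiIota1 G g ∈ chiG1 G from ⟨g, rfl⟩) hk) h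
    refine ⟨hE.1, hE.2, ?_⟩
    obtain ⟨t, ht, e⟩ := chi_F_pow hm g h hk n
    have hc : Commute (chiIota1 G k)⁻¹ (chiIota2 G k) := Commute.inv_left (chi_comm k)
    rw [hc.mul_pow, inv_pow, ← map_pow, ← map_pow, hn k] at e
    simp only [map_one, inv_one, mul_one, commutatorElement_one_right,
      commutatorElement_one_left] at e
    have e2 := eq_inv_of_mul_eq_one_left e.symm
    rw [pow_mul, e2]
    exact (Subgroup.inv_mem _ ht).2.2
  | one => simp [Subgroup.one_mem]
  | mul a b hxa hxb ha hb =>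
    obtain ⟨t, ht, e⟩ := chi_F_mul hm g h hxa hxb
    rw [e]
    exact Subgroup.mul_mem _ (Subgroup.mul_mem _ ha hb) (hT ht)
  | inv a hxa ha =>
    obtain ⟨t, ht, e⟩ := chi_F_mul hm g h hxa (Subgroup.inv_mem _ hxa)
    simp only [mul_inv_cancel, commutatorElement_one_right, commutatorElement_one_left] at e
    have e2 := eq_inv_of_mul_eq_one_left e.symm
    have e3 := eq_inv_mul_of_mul_eq e2
    rw [e3]
    exact Subgroup.mul_mem _ (Subgroup.inv_mem _ ha) (Subgroup.inv_mem _ (hT ht))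

theorem chi_R_le {n m : ℕ} (hn : ∀ g : G, g ^ n = 1) (hm : ∀ c ∈ commutator G, c ^ m = 1) :
    chiR G ≤ chiT G (n * m) := by
  rw [chiR, Subgroup.commutator_le]
  rintro x hx _ ⟨h, rfl⟩
  rw [Subgroup.commutator_def] at hx
  induction hx using Subgroup.closure_induction with
  | mem y hy =>
    obtain ⟨_, ⟨g, rfl⟩, l, hl, rfl⟩ := hy
    exact chi_F_T hn hm g h hl
  | one => simp [Subgroup.one_mem]
  | mul a b hxa hxb ha hb =>
    rw [chi_E_mul (L1_le_L hxa) hb.1]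
    exact Subgroup.mul_mem _ hb ha
  | inv a hxa ha =>
    have := chi_E_mul (u := chiIota2 G h) (Subgroup.inv_mem _ (L1_le_L hxa)) ha.1
    rw [inv_mul_cancel, commutatorElement_one_left] at this
    rw [eq_inv_of_mul_eq_one_right this.symm]
    exact Subgroup.inv_mem _ ha

end ChiAux

theorem exponent_chiR_dvd (G : Type*) [Group G] (n m : ℕ) (hn : 0 < n) (hm : 0 < m)
    (hGn : Monoid.exponent G = n)
    (hGm : Monoid.exponent (commutator G) = m) :
    Monoid.exponent (chiR G) ∣ n * m := by
  apply Monoid.exponent_dvd_of_forall_pow_eq_one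
  rintro ⟨x, hx⟩
  have h1 : ∀ g : G, g ^ n = 1 := fun g => by rw [← hGn]; exact Monoid.pow_exponent_eq_one g
  have h2 : ∀ c ∈ commutator G, c ^ m = 1 := fun c hc => by
    have := Monoid.pow_exponent_eq_one (⟨c, hc⟩ : commutator G)
    rw [hGm] at this
    exact congrArg Subtype.val this
  exact Subtype.ext (chi_R_le h1 h2 hx).2.2
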